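/- Every positive bounded six-times continuously differentiable solution v : ℝ → (0,∞) of the sixth-order Emden–Fowler ODE −v⁽⁶⁾ + K₄v⁽⁴⁾ − K₂v″ + K₀v = c_n·v^((n+6)/(n−6)) satisfies v(t) ≤ 1 for all t ∈ ℝ, i.e. sup_{t∈ℝ} v(t) ≤ 1. -/

import Mathlib

noncomputable section

def K4 (n : ℕ) : ℝ := (3*(n:ℝ)^2 - 12*(n:ℝ) + 44)/4
def K2 (n : ℕ) : ℝ := (3*(n:ℝ)^4 - 24*(n:ℝ)^3 + 72*(n:ℝ)^2 - 96*(n:ℝ) + 304)/16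
def K0 (n : ℕ) : ℝ := ((n:ℝ)-6)^2*((n:ℝ)-2)^2*((n:ℝ)+2)^2/64
def cst (n : ℕ) : ℝ := ((n:ℝ)-6)*((n:ℝ)-4)*((n:ℝ)-2)*(n:ℝ)*((n:ℝ)+2)*((n:ℝ)+4)/64

section Helpers
open Set Filter Topology

/-- first order operator -/
def op1 (α : ℝ) (y : ℝ → ℝ) : ℝ → ℝ := fun t => deriv y t + α * y t

/-- relatively bounded functions -/
def RelB (y : ℝ → ℝ) : Prop := ∃ C L : ℝ, 0 < L ∧ ∀ t, ∃ s ∈ Icc t (t + L), |y s| ≤ C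

def chainOp : List ℝ → (ℝ → ℝ) → (ℝ → ℝ)
  | [], y => y
  | α :: l, y => chainOp l (op1 α y)

lemma hasDeriv_F {α : ℝ} {y : ℝ → ℝ} (hy : Differentiable ℝ y) (t : ℝ) :
    HasDerivAt (fun s => Real.exp (α * s) * y s) (Real.exp (α * t) * op1 α y t) t := by
  have h1 : HasDerivAt (fun s : ℝ => Real.exp (α * s)) (Real.exp (α * t) * α) t := by
    have := ((hasDerivAt_id t).const_mul α).exp
    simpa using this
  have h2 := h1.mul (hy t).hasDerivAt
  refine HasDerivAt.congr_deriv h2 ?_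
  simp only [op1]; ring

lemma relB_step {α : ℝ} {y : ℝ → ℝ} (hy : Differentiable ℝ y) (h : RelB y) :
    RelB (op1 α y) := by
  obtain ⟨C, L, hL, h⟩ := h
  refine ⟨2 * C * Real.exp (|α| * (2 * L + 1)), 2 * L + 1, by linarith, fun t => ?_⟩
  obtain ⟨s, hs, hsC⟩ := h t
  obtain ⟨s', hs', hsC'⟩ := h (t + L + 1)
  have hlt : s + 1 ≤ s' := by linarith [hs.2, hs'.1]
  obtain ⟨ξ, hξ, hξe⟩ := exists_hasDerivAt_eq_slope (fun s => Real.exp (α * s) * y s)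
    (fun t => Real.exp (α * t) * op1 α y t) (by linarith : s < s')
    (fun x _ => (hasDeriv_F hy x).continuousAt.continuousWithinAt) (fun x _ => hasDeriv_F hy x)
  refine ⟨ξ, ⟨by linarith [hξ.1, hs.1], by linarith [hξ.2, hs'.2]⟩, ?_⟩
  have hC : 0 ≤ C := le_trans (abs_nonneg _) hsC
  have key : op1 α y ξ = (Real.exp (α * (s' - ξ)) * y s' - Real.exp (α * (s - ξ)) * y s) / (s' - s) := by
    have e1 : Real.exp (α * (s' - ξ)) = Real.exp (α * s') / Real.exp (α * ξ) := by
      rw [← Real.exp_sub]; ring_nf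
    have e2 : Real.exp (α * (s - ξ)) = Real.exp (α * s) / Real.exp (α * ξ) := by
      rw [← Real.exp_sub]; ring_nf
    have hne := (Real.exp_pos (α * ξ)).ne'
    have hne2 : s' - s ≠ 0 := by linarith
    rw [e1, e2]
    field_simp
    field_simp at hξe
    linarith
  have bnd : ∀ x : ℝ, |x - ξ| ≤ 2 * L + 1 → Real.exp (α * (x - ξ)) ≤ Real.exp (|α| * (2 * L + 1)) := by
    intro x hx
    apply Real.exp_le_exp.mpr
    calc α * (x - ξ) ≤ |α * (x - ξ)| := le_abs_self _
      _ = |α| * |x - ξ| := abs_mul _ _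
      _ ≤ _ := by gcongr
  have b1 := bnd s' (by rw [abs_le]; constructor <;> linarith [hξ.1, hξ.2, hs.1, hs'.2])
  have b2 := bnd s (by rw [abs_le]; constructor <;> linarith [hξ.1, hξ.2, hs.1, hs'.2])
  rw [key, abs_div]
  have h1 : 1 ≤ |s' - s| := by rw [abs_of_pos] <;> linarith
  have c1 : |Real.exp (α * (s' - ξ)) * y s'| ≤ Real.exp (|α| * (2 * L + 1)) * C := by
    rw [abs_mul, abs_of_pos (Real.exp_pos _)]; gcongr
  have c2 : |Real.exp (α * (s - ξ)) * y s| ≤ Real.exp (|α| * (2 * L + 1)) * C := by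
    rw [abs_mul, abs_of_pos (Real.exp_pos _)]; gcongr
  calc _ ≤ |Real.exp (α * (s' - ξ)) * y s' - Real.exp (α * (s - ξ)) * y s| := by
        apply div_le_self (abs_nonneg _) h1
    _ ≤ _ := by
        have := abs_sub (Real.exp (α * (s' - ξ)) * y s') (Real.exp (α * (s - ξ)) * y s)
        linarith

lemma relB_small {α : ℝ} (hα : 0 < α) {y : ℝ → ℝ} (h : RelB y) (T ε : ℝ) (hε : 0 < ε) :
    ∃ t < T, |Real.exp (α * t) * y t| < ε := by
  obtain ⟨C, L, hL, h⟩ := h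
  have hC : 0 ≤ C := by
    obtain ⟨s, _, hs⟩ := h 0
    exact le_trans (abs_nonneg _) hs
  have ht : Tendsto (fun t : ℝ => Real.exp (α * t) * C) atBot (𝓝 0) := by
    have : Tendsto (fun t : ℝ => Real.exp (α * t)) atBot (𝓝 0) :=
      Real.tendsto_exp_atBot.comp (tendsto_id.const_mul_atBot hα)
    simpa using this.mul_const C
  obtain ⟨t0, ht0⟩ := ((ht.eventually (gt_mem_nhds hε)).and (eventually_lt_atBot T)).exists
  obtain ⟨s, hs, hsC⟩ := h (t0 - L)
  have hst : s ≤ t0 := by linarith [hs.2]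
  refine ⟨s, lt_of_le_of_lt hst ht0.2, lt_of_le_of_lt ?_ ht0.1⟩
  rw [abs_mul, abs_of_pos (Real.exp_pos _)]
  gcongr

lemma rolle_bump {F : ℝ → ℝ} (hF : Continuous F) {t x z : ℝ} (h1 : t < x) (h2 : x < z)
    (ht : |F t| < |F x|) (hz : |F z| < |F x|) : ∃ ξ ∈ Ioo t z, IsLocalExtr F ξ := by
  have main : ∀ G : ℝ → ℝ, Continuous G → G t < G x → G z < G x → ∃ ξ ∈ Ioo t z, IsLocalMax G ξ := by
    intro G hG ht hz
    obtain ⟨ξ, hξ, hmax⟩ := isCompact_Icc.exists_isMaxOn (⟨x, h1.le, h2.le⟩ : (Icc t z).Nonempty) hG.continuousOn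
    have hx : G x ≤ G ξ := hmax ⟨h1.le, h2.le⟩
    have a1 : ξ ≠ t := by rintro rfl; linarith
    have a2 : ξ ≠ z := by rintro rfl; linarith
    have hm : ξ ∈ Ioo t z := ⟨lt_of_le_of_ne hξ.1 a1.symm, lt_of_le_of_ne hξ.2 a2⟩
    exact ⟨ξ, hm, hmax.isLocalMax (Icc_mem_nhds hm.1 hm.2)⟩
  rcases le_total 0 (F x) with h | h
  · rw [abs_of_nonneg h] at ht hz
    obtain ⟨ξ, hm, hh⟩ := main F hF (lt_of_le_of_lt (le_abs_self _) ht) (lt_of_le_of_lt (le_abs_self _) hz)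
    exact ⟨ξ, hm, Or.inr hh⟩
  · rw [abs_of_nonpos h] at ht hz
    obtain ⟨ξ, hm, hh⟩ := main (fun s => - F s) hF.neg (lt_of_le_of_lt (neg_le_abs _) ht) (lt_of_le_of_lt (neg_le_abs _) hz)
    refine ⟨ξ, hm, Or.inl ?_⟩
    have h5 := hh.neg
    simp only [neg_neg] at h5
    exact h5

lemma op_zero_of_extr {α : ℝ} {y : ℝ → ℝ} (hy : Differentiable ℝ y) {ξ : ℝ}
    (h : IsLocalExtr (fun s => Real.exp (α * s) * y s) ξ) : op1 α y ξ = 0 := by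
  have := h.hasDerivAt_eq_zero (hasDeriv_F hy ξ)
  exact (mul_eq_zero.mp this).resolve_left (Real.exp_pos _).ne'

lemma contF {α : ℝ} {y : ℝ → ℝ} (hy : Differentiable ℝ y) :
    Continuous (fun s => Real.exp (α * s) * y s) := by
  have := hy.continuous
  fun_prop

lemma op_rolle (α : ℝ) {y : ℝ → ℝ} (hy : Differentiable ℝ y) {s t : ℝ} (hst : s < t)
    (hs : y s = 0) (ht : y t = 0) : ∃ ξ ∈ Ioo s t, op1 α y ξ = 0 := by
  obtain ⟨ξ, hm, h⟩ := exists_isLocalExtr_Ioo hst (contF (α := α) hy).continuousOn (by simp [hs, ht])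
  exact ⟨ξ, hm, op_zero_of_extr hy h⟩

lemma op_rolle_left {α : ℝ} (hα : 0 < α) {y : ℝ → ℝ} (hy : Differentiable ℝ y) (hb : RelB y) {z : ℝ}
    (hz : y z = 0) : ∃ ξ < z, op1 α y ξ = 0 := by
  by_cases h0 : y (z - 1) = 0
  · obtain ⟨ξ, hm, h⟩ := op_rolle α hy (by linarith : z - 1 < z) h0 hz
    exact ⟨ξ, hm.2, h⟩
  · have hpos : 0 < |Real.exp (α * (z - 1)) * y (z - 1)| := by
      apply abs_pos.mpr; exact mul_ne_zero (Real.exp_pos _).ne' h0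
    obtain ⟨t, ht, hts⟩ := relB_small hα hb (z - 1) _ hpos
    obtain ⟨ξ, hm, h⟩ := rolle_bump (contF (α := α) hy) ht (by linarith : z - 1 < z) hts (by
      simp only [hz, mul_zero, abs_zero]; exact hpos)
    exact ⟨ξ, hm.2, op_zero_of_extr hy h⟩

/-- zero counting, positive α -/
lemma zero_count_pos {α : ℝ} (hα : 0 < α) {y : ℝ → ℝ} (hy : Differentiable ℝ y) (hb : RelB y)
    (Z : Finset ℝ) : (∀ z ∈ Z, y z = 0) → ∃ Z' : Finset ℝ, Z'.card = Z.card ∧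
      (∀ x ∈ Z', op1 α y x = 0) ∧ (∀ x ∈ Z', ∃ z ∈ Z, x < z) ∧ (∀ x ∈ Z', x ∉ Z) := by
  induction Z using Finset.induction_on_max with
  | empty => intro _; exact ⟨∅, by simp⟩
  | insert m Z hm ih =>
    intro hZ
    obtain ⟨Z', hc, h1, h2, h3⟩ := ih (fun z hz => hZ z (Finset.mem_insert_of_mem hz))
    have hmZ : m ∉ Z := fun h => lt_irrefl _ (hm m h)
    have hym : y m = 0 := hZ m (Finset.mem_insert_self _ _)
    have : ∃ ξ < m, op1 α y ξ = 0 ∧ ∀ z ∈ Z, z < ξ := by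
      rcases Z.eq_empty_or_nonempty with rfl | hne
      · obtain ⟨ξ, hξ, h⟩ := op_rolle_left hα hy hb hym
        exact ⟨ξ, hξ, h, by simp⟩
      · have hmem := Z.max'_mem hne
        obtain ⟨ξ, hξ, h⟩ := op_rolle α hy (hm _ hmem) (hZ _ (Finset.mem_insert_of_mem hmem)) hym
        exact ⟨ξ, hξ.2, h, fun z hz => lt_of_le_of_lt (Z.le_max' z hz) hξ.1⟩
    obtain ⟨ξ, hξm, hξ0, hξZ⟩ := this
    have hξZ' : ξ ∉ Z' := by
      intro h
      obtain ⟨z, hz, hlt⟩ := h2 ξ h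
      exact lt_asymm hlt (hξZ z hz)
    refine ⟨insert ξ Z', ?_, ?_, ?_, ?_⟩
    · rw [Finset.card_insert_of_notMem hξZ', Finset.card_insert_of_notMem hmZ, hc]
    · intro x hx
      rcases Finset.mem_insert.mp hx with rfl | hx
      · exact hξ0
      · exact h1 x hx
    · intro x hx
      rcases Finset.mem_insert.mp hx with rfl | hx
      · exact ⟨m, Finset.mem_insert_self _ _, hξm⟩
      · obtain ⟨z, hz, h⟩ := h2 x hx
        exact ⟨z, Finset.mem_insert_of_mem hz, h⟩
    · intro x hx hx'
      rcases Finset.mem_insert.mp hx with rfl | hx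
      · rcases Finset.mem_insert.mp hx' with h | h
        · exact hξm.ne h
        · exact lt_irrefl _ (hξZ x h)
      · rcases Finset.mem_insert.mp hx' with rfl | h
        · obtain ⟨z, hz, h⟩ := h2 x hx
          exact lt_asymm h (hm z hz)
        · exact h3 x hx h

lemma relB_neg {y : ℝ → ℝ} (h : RelB y) : RelB (fun t => y (-t)) := by
  obtain ⟨C, L, hL, h⟩ := h
  refine ⟨C, L, hL, fun t => ?_⟩
  obtain ⟨s, hs, hC⟩ := h (-t - L)
  exact ⟨-s, ⟨by linarith [hs.2], by linarith [hs.1]⟩, by simpa using hC⟩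

lemma op_neg (α : ℝ) (y : ℝ → ℝ) (t : ℝ) : op1 (-α) (fun t => y (-t)) t = - op1 α y (-t) := by
  simp only [op1]
  rw [deriv_comp_neg]
  ring

lemma zero_count {α : ℝ} (hα : α ≠ 0) {y : ℝ → ℝ} (hy : Differentiable ℝ y) (hb : RelB y)
    (Z : Finset ℝ) (hZ : ∀ z ∈ Z, y z = 0) : ∃ Z' : Finset ℝ, Z'.card = Z.card ∧
      (∀ x ∈ Z', op1 α y x = 0) := by
  rcases lt_or_gt_of_ne hα with h | h
  · obtain ⟨Z', hc, h1, -, -⟩ := zero_count_pos (neg_pos.mpr h) (y := fun t => y (-t))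
      (hy.comp differentiable_neg) (relB_neg hb) (Z.image (fun x => -x)) (by
        intro z hz
        obtain ⟨w, hw, rfl⟩ := Finset.mem_image.mp hz
        simpa using hZ w hw)
    refine ⟨Z'.image (fun x => -x), ?_, ?_⟩
    · rw [Finset.card_image_of_injective _ neg_injective, hc, Finset.card_image_of_injective _ neg_injective]
    · intro x hx
      obtain ⟨w, hw, rfl⟩ := Finset.mem_image.mp hx
      have := h1 w hw
      rw [op_neg] at this
      linarith
  · obtain ⟨Z', hc, h1, -, -⟩ := zero_count_pos h hy hb Z hZ
    exact ⟨Z', hc, h1⟩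

lemma contDiff_op {α : ℝ} {y : ℝ → ℝ} {k : ℕ} (hy : ContDiff ℝ ((k + 1 : ℕ) : WithTop ℕ∞) y) :
    ContDiff ℝ (k : WithTop ℕ∞) (op1 α y) := by
  have h1 : ContDiff ℝ (k : WithTop ℕ∞) (deriv y) := by
    have := (contDiff_succ_iff_deriv (n := (k : WithTop ℕ∞)) (f := y)).mp (by exact_mod_cast hy)
    exact this.2.2
  exact h1.add (contDiff_const.mul (hy.of_le (by exact_mod_cast Nat.le_succ k)))

lemma diff_of {y : ℝ → ℝ} {k : ℕ} (hy : ContDiff ℝ ((k + 1 : ℕ) : WithTop ℕ∞) y) : Differentiable ℝ y :=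
  hy.differentiable (by exact_mod_cast Nat.succ_ne_zero k)

lemma chain_zero_count (l : List ℝ) (hl : ∀ α ∈ l, α ≠ 0) : ∀ (y : ℝ → ℝ),
    ContDiff ℝ (l.length : WithTop ℕ∞) y → RelB y →
    ∀ Z : Finset ℝ, (∀ z ∈ Z, y z = 0) → ∃ Z' : Finset ℝ, Z'.card = Z.card ∧
      (∀ x ∈ Z', chainOp l y x = 0) := by
  induction l with
  | nil => intro y _ _ Z hZ; exact ⟨Z, rfl, hZ⟩
  | cons α l ih =>
    intro y hy hb Z hZ
    have hy' : ContDiff ℝ ((l.length + 1 : ℕ) : WithTop ℕ∞) y := by simpa using hy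
    have hd := diff_of hy'
    obtain ⟨Z', hc, h1⟩ := zero_count (hl α (by simp)) hd hb Z hZ
    obtain ⟨Z'', hc', h2⟩ := ih (fun β hβ => hl β (by simp [hβ])) (op1 α y) (contDiff_op hy')
      (relB_step hd hb) Z' h1
    exact ⟨Z'', hc'.trans hc, h2⟩

lemma op_pos {α : ℝ} (hα : 0 < α) {y : ℝ → ℝ} (hy : Differentiable ℝ y) (hb : RelB y)
    (h : ∀ t, 0 < op1 α y t) (t : ℝ) : 0 < y t := by
  have hmono : StrictMono (fun s => Real.exp (α * s) * y s) := by
    apply strictMono_of_deriv_pos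
    intro x
    rw [(hasDeriv_F hy x).deriv]
    exact mul_pos (Real.exp_pos _) (h x)
  by_contra hn
  have h1 : Real.exp (α * t) * y t ≤ 0 := mul_nonpos_of_nonneg_of_nonpos (Real.exp_pos _).le (not_lt.mp hn)
  have h2 : Real.exp (α * (t-1)) * y (t-1) < Real.exp (α * t) * y t := hmono (by linarith)
  obtain ⟨s, hs, hss⟩ := relB_small hα hb (t - 1) (-(Real.exp (α * (t-1)) * y (t-1))) (by linarith)
  have h3 : Real.exp (α * s) * y s < Real.exp (α * (t-1)) * y (t-1) := hmono hs
  have := neg_le_abs (Real.exp (α * s) * y s)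
  linarith

lemma op_pos' {α : ℝ} (hα : 0 < α) {y : ℝ → ℝ} (hy : Differentiable ℝ y) (hb : RelB y)
    (h : ∀ t, op1 (-α) y t < 0) (t : ℝ) : 0 < y t := by
  have := op_pos hα (y := fun t => y (-t)) (hy.comp differentiable_neg) (relB_neg hb) (by
    intro t
    have := op_neg (-α) y t
    rw [neg_neg] at this
    rw [this]
    linarith [h (-t)]) (-t)
  simpa using this

/-- integration step -/
lemma decay_step {α ρ K B : ℝ} (hK : 0 < K) (hρ : K ≤ ρ - α) (hB : 0 ≤ B) {y : ℝ → ℝ}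
    (hy : Differentiable ℝ y) {s z : ℝ} (hsz : s ≤ z) (hz : y z = 0)
    (h : ∀ x ∈ Icc s z, |op1 α y x| ≤ B * Real.exp (-ρ * x)) :
    |y s| ≤ B / K * Real.exp (-ρ * s) := by
  have main : ∀ u : ℝ → ℝ, Differentiable ℝ u → u z = 0 →
      (∀ x ∈ Icc s z, op1 α u x ≤ B * Real.exp (-ρ * x)) → - u s ≤ B / K * Real.exp (-ρ * s) := by
    intro u hu huz hb
    set δ := ρ - α with hδ
    have hδp : 0 < δ := by linarith
    have hder : ∀ x, HasDerivAt (fun x => Real.exp (α * x) * u x + B / δ * Real.exp (-δ * x))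
        (Real.exp (α * x) * op1 α u x + B / δ * (Real.exp (-δ * x) * (-δ))) x := by
      intro x
      have e : HasDerivAt (fun s : ℝ => Real.exp (-δ * s)) (Real.exp (-δ * x) * (-δ)) x := by
        simpa using ((hasDerivAt_id x).const_mul (-δ)).exp
      exact (hasDeriv_F hu x).add (e.const_mul (B / δ))
    have hanti : AntitoneOn (fun x => Real.exp (α * x) * u x + B / δ * Real.exp (-δ * x)) (Icc s z) := by
      apply antitoneOn_of_deriv_nonpos (convex_Icc s z)
        (fun x _ => (hder x).continuousAt.continuousWithinAt)
        (fun x _ => (hder x).differentiableAt.differentiableWithinAt)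
      intro x hx
      rw [interior_Icc] at hx
      rw [(hder x).deriv]
      have h1 := hb x ⟨hx.1.le, hx.2.le⟩
      have h2 : Real.exp (α * x) * (B * Real.exp (-ρ * x)) = B * Real.exp (-δ * x) := by
        rw [mul_left_comm, ← Real.exp_add]; congr 2; rw [hδ]; ring
      have h3 : B / δ * (Real.exp (-δ * x) * (-δ)) = - (B * Real.exp (-δ * x)) := by
        field_simp
      have h4 := mul_le_mul_of_nonneg_left h1 (Real.exp_pos (α * x)).le
      linarith
    have h1 := hanti (left_mem_Icc.mpr hsz) (right_mem_Icc.mpr hsz) hsz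
    simp only [huz, mul_zero, zero_add] at h1
    have h2 : 0 ≤ B / δ * Real.exp (-δ * z) := by positivity
    have h3 : - (Real.exp (α * s) * u s) ≤ B / δ * Real.exp (-δ * s) := by linarith
    have h4 : - u s ≤ B / δ * Real.exp (-ρ * s) := by
      have e : Real.exp (-ρ * s) = Real.exp (-δ * s) * Real.exp (-α * s) := by
        rw [← Real.exp_add]; congr 1; rw [hδ]; ring
      have e2 : Real.exp (α * s) * Real.exp (-α * s) = 1 := by
        rw [← Real.exp_add]; ring_nf; simp
      have := mul_le_mul_of_nonneg_right h3 (Real.exp_pos (-α * s)).le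
      calc - u s = - (Real.exp (α * s) * u s) * Real.exp (-α * s) := by
            linear_combination (u s) * e2
        _ ≤ _ := this
        _ = _ := by rw [e]; ring
    refine h4.trans ?_
    gcongr
  rw [abs_le]
  constructor
  · have := main y hy hz (fun x hx => (le_abs_self _).trans (h x hx))
    linarith
  · have := main (fun x => - y x) hy.neg (by simp [hz]) (fun x hx => by
      have e : op1 α (fun x => - y x) x = - op1 α y x := by
        simp only [op1, deriv.fun_neg]; ring
      rw [e]
      exact (neg_le_abs _).trans (h x hx))
    simpa using this

lemma decay_inf (l : List ℝ) {ρ B T : ℝ} (hB : 0 ≤ B) (hl : ∀ α ∈ l, 1 ≤ ρ - α) : ∀ (y : ℝ → ℝ),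
    ContDiff ℝ (l.length : WithTop ℕ∞) y → (∀ N, ∃ z > N, y z = 0) →
    (∀ x ≥ T, |chainOp l y x| ≤ B * Real.exp (-ρ * x)) → ∀ x ≥ T, |y x| ≤ B * Real.exp (-ρ * x) := by
  induction l with
  | nil => intro y _ _ h; exact h
  | cons α l ih =>
    intro y hy hz h x hx
    have hy' : ContDiff ℝ ((l.length + 1 : ℕ) : WithTop ℕ∞) y := by simpa using hy
    have hd := diff_of hy'
    have h1 := ih (fun β hβ => hl β (by simp [hβ])) (op1 α y) (contDiff_op hy') (by
      intro N
      obtain ⟨z, hzN, hz0⟩ := hz N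
      obtain ⟨z', hzz, hz0'⟩ := hz z
      obtain ⟨ξ, hξ, h0⟩ := op_rolle α hd hzz hz0 hz0'
      exact ⟨ξ, lt_trans hzN hξ.1, h0⟩) h
    obtain ⟨z, hzx, hz0⟩ := hz x
    have := decay_step (α := α) (ρ := ρ) one_pos (hl α (by simp)) hB hd hzx.le hz0 (fun w hw => h1 w (le_trans hx hw.1))
    simpa using this

lemma acc_zero {y : ℝ → ℝ} (hy : Continuous y) {p : ℝ} (h : ∃ᶠ z in 𝓝[≠] p, y z = 0) : y p = 0 := by
  by_contra hne
  have : ∀ᶠ z in 𝓝 p, y z ≠ 0 := hy.continuousAt.eventually_ne hne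
  exact h (this.filter_mono nhdsWithin_le_nhds)

lemma acc_op {α : ℝ} {y : ℝ → ℝ} (hy : Differentiable ℝ y) {p : ℝ} (h : ∃ᶠ z in 𝓝[≠] p, y z = 0) :
    ∃ᶠ z in 𝓝[≠] p, op1 α y z = 0 := by
  have h0 := acc_zero hy.continuous h
  rw [frequently_nhdsWithin_iff] at h ⊢
  rw [Metric.nhds_basis_ball.frequently_iff] at h ⊢
  intro ε hε
  obtain ⟨z, hz, hz0, hzp⟩ := h ε hε
  rw [Metric.mem_ball, Real.dist_eq, abs_lt] at hz
  rcases lt_or_gt_of_ne (hzp : z ≠ p) with hlt | hlt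
  · obtain ⟨ξ, hξ, h1⟩ := op_rolle α hy hlt hz0 h0
    refine ⟨ξ, ?_, h1, hξ.2.ne⟩
    rw [Metric.mem_ball, Real.dist_eq, abs_lt]
    constructor <;> linarith [hξ.1, hξ.2]
  · obtain ⟨ξ, hξ, h1⟩ := op_rolle α hy hlt h0 hz0
    refine ⟨ξ, ?_, h1, hξ.1.ne'⟩
    rw [Metric.mem_ball, Real.dist_eq, abs_lt]
    constructor <;> linarith [hξ.1, hξ.2]

lemma decay_fin (l : List ℝ) {ρ K B T p : ℝ} (hB : 0 ≤ B) (hK : 0 < K) (hl : ∀ α ∈ l, K ≤ ρ - α) :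
    ∀ (y : ℝ → ℝ),
    ContDiff ℝ (l.length : WithTop ℕ∞) y → (∃ᶠ z in 𝓝[≠] p, y z = 0) →
    (∀ x ∈ Icc T p, |chainOp l y x| ≤ B * Real.exp (-ρ * x)) →
    ∀ x ∈ Icc T p, |y x| ≤ B / K ^ l.length * Real.exp (-ρ * x) := by
  induction l with
  | nil => intro y _ _ h; simpa [chainOp] using h
  | cons α l ih =>
    intro y hy hz h x hx
    have hy' : ContDiff ℝ ((l.length + 1 : ℕ) : WithTop ℕ∞) y := by simpa using hy
    have hd := diff_of hy'
    have h1 := ih (fun β hβ => hl β (by simp [hβ])) (op1 α y) (contDiff_op hy') (acc_op hd hz) h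
    have := decay_step (α := α) (ρ := ρ) hK (hl α (by simp)) (by positivity) hd hx.2
      (acc_zero hd.continuous hz) (fun w hw => h1 w ⟨le_trans hx.1 hw.1, hw.2⟩)
    rw [div_div, ← pow_succ] at this
    simpa using this

lemma zero_of_halving {x A : ℝ} (h : ∀ k : ℕ, |x| ≤ A * (1 / 2) ^ k) : x = 0 := by
  have ht : Tendsto (fun k : ℕ => A * (1 / 2 : ℝ) ^ k) atTop (𝓝 0) := by
    simpa using (tendsto_pow_atTop_nhds_zero_of_lt_one (by norm_num : (0:ℝ) ≤ 1/2) (by norm_num)).const_mul A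
  have := ge_of_tendsto' ht h
  exact abs_eq_zero.mp (le_antisymm this (abs_nonneg _))

/-- uniqueness to the left of an accumulation point of zeros -/
lemma unique_left (l : List ℝ) (hlen : 1 ≤ l.length) {C M p : ℝ} (y : ℝ → ℝ)
    (hy : ContDiff ℝ (l.length : WithTop ℕ∞) y) (hM : ∀ t, |y t| ≤ M)
    (hC : ∀ t, |chainOp l y t| ≤ C * |y t|) (hz : ∃ᶠ z in 𝓝[≠] p, y z = 0) :
    ∀ x ≤ p, y x = 0 := by
  intro T hT
  have hM0 : 0 ≤ M := (abs_nonneg _).trans (hM 0)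
  set K := 2 * |C| + 1 with hK
  have hK1 : 1 ≤ K := by rw [hK]; linarith [abs_nonneg C]
  obtain ⟨m, hm⟩ : ∃ m : ℝ, 0 ≤ m ∧ ∀ α ∈ l, α ≤ m := by
    refine ⟨(l.map abs).sum, List.sum_nonneg (by simp), fun α hα => ?_⟩
    exact (le_abs_self α).trans (List.single_le_sum (by simp) _ (List.mem_map_of_mem hα))
  set ρ := K + m with hρ
  have hl : ∀ α ∈ l, K ≤ ρ - α := fun α hα => by have := hm.2 α hα; linarith
  have key : ∀ k : ℕ, ∀ x ∈ Icc T p, |y x| ≤ (M * Real.exp (ρ * p)) * (1/2) ^ k * Real.exp (-ρ * x) := by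
    intro k
    induction k with
    | zero =>
      intro x hx
      have : 1 ≤ Real.exp (ρ * p) * Real.exp (-ρ * x) := by
        rw [← Real.exp_add]
        apply Real.one_le_exp
        have : 0 ≤ ρ := by linarith [hm.1]
        nlinarith [hx.2]
      calc |y x| ≤ M * 1 := by rw [mul_one]; exact hM x
        _ ≤ M * (Real.exp (ρ * p) * Real.exp (-ρ * x)) := by gcongr
        _ = _ := by ring
    | succ k ih =>
      intro x hx
      set A := (M * Real.exp (ρ * p)) * (1/2) ^ k with hA
      have hA0 : 0 ≤ A := by positivity
      have := decay_fin l (ρ := ρ) (K := K) (B := |C| * A) (T := T) (p := p) (by positivity) (by linarith) hl y hy hz (by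
        intro x hx
        refine (hC x).trans ?_
        have h1 := ih x hx
        calc C * |y x| ≤ |C| * |y x| := by gcongr; exact le_abs_self _
          _ ≤ |C| * (A * Real.exp (-ρ * x)) := by gcongr
          _ = _ := by ring) x hx
      refine this.trans ?_
      have e : (M * Real.exp (ρ * p)) * (1/2) ^ (k+1) = A * (1 / 2) := by rw [hA, pow_succ]; ring
      rw [e]
      gcongr
      have h2 : K ≤ K ^ l.length := le_self_pow₀ hK1 (by omega)
      calc |C| * A / K ^ l.length ≤ |C| * A / K := by gcongr
        _ ≤ A * (1/2) := by
          rw [div_le_iff₀ (by linarith)]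
          rw [hK]; nlinarith [abs_nonneg C]
  apply zero_of_halving (A := (M * Real.exp (ρ * p)) * Real.exp (-ρ * T))
  intro k
  have := key k T ⟨le_rfl, hT⟩
  linarith


def chL (a : ℝ) : List ℝ := [a, a + 2, a + 4, -a, -(a + 2), -(a + 4)]
def cC (a : ℝ) : ℝ := a * (a + 1) * (a + 2) * (a + 3) * (a + 4) * (a + 5)
def k4 (a : ℝ) : ℝ := a ^ 2 + (a + 2) ^ 2 + (a + 4) ^ 2
def k2 (a : ℝ) : ℝ := a ^ 2 * (a + 2) ^ 2 + a ^ 2 * (a + 4) ^ 2 + (a + 2) ^ 2 * (a + 4) ^ 2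
def k0 (a : ℝ) : ℝ := a ^ 2 * (a + 2) ^ 2 * (a + 4) ^ 2

structure Sol (a : ℝ) (v : ℝ → ℝ) : Prop where
  cd : ContDiff ℝ 6 v
  pos : ∀ t, 0 < v t
  bdd : ∃ C, ∀ t, v t ≤ C
  ode : ∀ t, iteratedDeriv 6 v t - k4 a * iteratedDeriv 4 v t + k2 a * iteratedDeriv 2 v t
    - k0 a * v t = -(cC a * v t ^ ((a + 6) / a))

lemma hasDeriv_iter {y : ℝ → ℝ} (hy : ContDiff ℝ 6 y) (k : ℕ) (hk : k < 6) (t : ℝ) :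
    HasDerivAt (iteratedDeriv k y) (iteratedDeriv (k + 1) y t) t := by
  rw [iteratedDeriv_succ]
  have := hy.differentiable_iteratedDeriv k (by exact_mod_cast hk)
  exact (this t).hasDerivAt

lemma chain_eq (a : ℝ) {y : ℝ → ℝ} (hy : ContDiff ℝ 6 y) (t : ℝ) :
    chainOp (chL a) y t = iteratedDeriv 6 y t - k4 a * iteratedDeriv 4 y t
      + k2 a * iteratedDeriv 2 y t - k0 a * y t := by
  have step : ∀ (α c0 c1 c2 c3 c4 c5 : ℝ),
    op1 α (fun t => c0 * iteratedDeriv 0 y t + c1 * iteratedDeriv 1 y t + c2 * iteratedDeriv 2 y t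
      + c3 * iteratedDeriv 3 y t + c4 * iteratedDeriv 4 y t + c5 * iteratedDeriv 5 y t) =
    (fun t => α * c0 * iteratedDeriv 0 y t + (c0 + α * c1) * iteratedDeriv 1 y t
      + (c1 + α * c2) * iteratedDeriv 2 y t
      + (c2 + α * c3) * iteratedDeriv 3 y t + (c3 + α * c4) * iteratedDeriv 4 y t
      + (c4 + α * c5) * iteratedDeriv 5 y t + c5 * iteratedDeriv 6 y t) := by
    intro α c0 c1 c2 c3 c4 c5
    funext t
    have h := ((((((hasDeriv_iter hy 0 (by norm_num) t).const_mul c0).add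
      ((hasDeriv_iter hy 1 (by norm_num) t).const_mul c1)).add
      ((hasDeriv_iter hy 2 (by norm_num) t).const_mul c2)).add
      ((hasDeriv_iter hy 3 (by norm_num) t).const_mul c3)).add
      ((hasDeriv_iter hy 4 (by norm_num) t).const_mul c4)).add
      ((hasDeriv_iter hy 5 (by norm_num) t).const_mul c5)
    have h' := h.deriv
    simp only [op1]
    refine Eq.trans (congrArg (· + _) h') ?_
    norm_num
    ring
  have step' : ∀ (α c0 c1 c2 c3 c4 : ℝ),
    op1 α (fun t => c0 * iteratedDeriv 0 y t + c1 * iteratedDeriv 1 y t + c2 * iteratedDeriv 2 y t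
      + c3 * iteratedDeriv 3 y t + c4 * iteratedDeriv 4 y t + 0 * iteratedDeriv 5 y t) =
    (fun t => α * c0 * iteratedDeriv 0 y t + (c0 + α * c1) * iteratedDeriv 1 y t
      + (c1 + α * c2) * iteratedDeriv 2 y t
      + (c2 + α * c3) * iteratedDeriv 3 y t + (c3 + α * c4) * iteratedDeriv 4 y t
      + c4 * iteratedDeriv 5 y t) := by
    intro α c0 c1 c2 c3 c4
    rw [step]; funext t; ring
  have e0 : y = (fun t => 1 * iteratedDeriv 0 y t + 0 * iteratedDeriv 1 y t + 0 * iteratedDeriv 2 y t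
      + 0 * iteratedDeriv 3 y t + 0 * iteratedDeriv 4 y t + 0 * iteratedDeriv 5 y t) := by
    funext t; simp
  have e1 : chainOp (chL a) y = chainOp (chL a) (fun t => 1 * iteratedDeriv 0 y t + 0 * iteratedDeriv 1 y t + 0 * iteratedDeriv 2 y t
      + 0 * iteratedDeriv 3 y t + 0 * iteratedDeriv 4 y t + 0 * iteratedDeriv 5 y t) := by
    rw [← e0]
  rw [e1]
  have z : ∀ α : ℝ, (0:ℝ) + α * 0 = 0 := by intro α; ring
  simp only [chL, chainOp, step', z]
  rw [step]
  simp only [iteratedDeriv_zero, k4, k2, k0]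
  ring

lemma iter_eq (f : ℕ → ℝ → ℝ) (h : ∀ k t, k < 6 → HasDerivAt (f k) (f (k + 1) t) t) :
    ∀ k, k ≤ 6 → iteratedDeriv k (f 0) = f k := by
  intro k
  induction k with
  | zero => intro _; simp
  | succ k ih =>
    intro hk
    rw [iteratedDeriv_succ, ih (by omega)]
    funext t
    exact (h k t (by omega)).deriv

def Eb (m : ℝ) : ℝ → ℝ := fun t => Real.cosh t ^ (-m)
def Tb (m : ℝ) : ℝ → ℝ := fun t => Real.sinh t * Real.cosh t ^ (-m - 1)

lemma hasDeriv_Eb (m t : ℝ) : HasDerivAt (Eb m) (-m * Tb m t) t := by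
  have h := (Real.hasDerivAt_cosh t).rpow_const (p := -m) (Or.inl (Real.cosh_pos t).ne')
  refine HasDerivAt.congr_deriv h ?_
  simp only [Tb]; ring

lemma hasDeriv_Tb (m t : ℝ) : HasDerivAt (Tb m) (-m * Eb m t + (m + 1) * Eb (m + 2) t) t := by
  have h := (Real.hasDerivAt_sinh t).mul ((Real.hasDerivAt_cosh t).rpow_const (p := -m - 1) (Or.inl (Real.cosh_pos t).ne'))
  refine HasDerivAt.congr_deriv h ?_
  simp only [Eb]
  have hc := Real.cosh_pos t
  have e1 : Real.cosh t ^ (-m) = Real.cosh t ^ (-(m+2)) * Real.cosh t ^ 2 := by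
    rw [← Real.rpow_natCast, ← Real.rpow_add hc]; congr 1; push_cast; ring
  have e2 : Real.cosh t ^ (-m - 1) = Real.cosh t ^ (-(m+2)) * Real.cosh t := by
    rw [← Real.rpow_add_one hc.ne']; congr 1; ring
  have e3 : Real.cosh t ^ (-m - 1 - 1) = Real.cosh t ^ (-(m+2)) := by congr 1; ring
  rw [e1, e2, e3]
  have := Real.cosh_sq t
  linear_combination (Real.cosh t ^ (-(m+2))) * (-m - 1) * (-1) * this

def fb (a : ℝ) : ℕ → ℝ → ℝ
  | 0 => Eb a
  | 1 => fun t => -a * Tb a t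
  | 2 => fun t => a ^ 2 * Eb a t - a * (a + 1) * Eb (a + 2) t
  | 3 => fun t => -a ^ 3 * Tb a t + a * (a + 1) * (a + 2) * Tb (a + 2) t
  | 4 => fun t => a ^ 4 * Eb a t - (a ^ 3 * (a + 1) + a * (a + 1) * (a + 2) ^ 2) * Eb (a + 2) t
      + a * (a + 1) * (a + 2) * (a + 3) * Eb (a + 2 + 2) t
  | 5 => fun t => - a ^ 5 * Tb a t + (a ^ 3 * (a + 1) + a * (a + 1) * (a + 2) ^ 2) * (a + 2) * Tb (a + 2) t
      - a * (a + 1) * (a + 2) * (a + 3) * (a + 4) * Tb (a + 2 + 2) t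
  | _ => fun t => a ^ 6 * Eb a t - a ^ 5 * (a + 1) * Eb (a + 2) t
      - (a ^ 3 * (a + 1) + a * (a + 1) * (a + 2) ^ 2) * (a + 2) * ((a + 2) * Eb (a + 2) t - (a + 3) * Eb (a + 2 + 2) t)
      + a * (a + 1) * (a + 2) * (a + 3) * (a + 4) * ((a + 4) * Eb (a + 2 + 2) t - (a + 5) * Eb (a + 2 + 2 + 2) t)

lemma fb_deriv (a : ℝ) : ∀ k t, k < 6 → HasDerivAt (fb a k) (fb a (k + 1) t) t := by
  intro k t hk
  have E0 := hasDeriv_Eb a t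
  have E2 := hasDeriv_Eb (a + 2) t
  have E4 := hasDeriv_Eb (a + 2 + 2) t
  have T0 := hasDeriv_Tb a t
  have T2 := hasDeriv_Tb (a + 2) t
  have T4 := hasDeriv_Tb (a + 2 + 2) t
  interval_cases k
  · exact E0
  · refine HasDerivAt.congr_deriv (T0.const_mul (-a)) ?_
    simp only [fb]; ring
  · refine HasDerivAt.congr_deriv ((E0.const_mul (a ^ 2)).sub (E2.const_mul (a * (a + 1)))) ?_
    simp only [fb]; ring
  · refine HasDerivAt.congr_deriv ((T0.const_mul (-a ^ 3)).add (T2.const_mul (a * (a + 1) * (a + 2)))) ?_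
    simp only [fb]; ring
  · refine HasDerivAt.congr_deriv (((E0.const_mul (a ^ 4)).sub (E2.const_mul _)).add (E4.const_mul _)) ?_
    simp only [fb]; ring
  · refine HasDerivAt.congr_deriv (((T0.const_mul (-a ^ 5)).add (T2.const_mul _)).sub (T4.const_mul _)) ?_
    simp only [fb]; ring

lemma Eb_pos (m t : ℝ) : 0 < Eb m t := Real.rpow_pos_of_pos (Real.cosh_pos t) _

lemma Eb_le_one {m : ℝ} (hm : 0 < m) (t : ℝ) : Eb m t ≤ 1 :=
  Real.rpow_le_one_of_one_le_of_nonpos (Real.one_le_cosh t) (by linarith)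

lemma Eb_contDiff (m : ℝ) : ContDiff ℝ 6 (Eb m) := by
  unfold Eb
  exact Real.contDiff_cosh.rpow_const_of_ne (fun t => (Real.cosh_pos t).ne')

lemma sol_Eb {a : ℝ} (ha : 0 < a) : Sol a (Eb a) where
  cd := Eb_contDiff a
  pos := Eb_pos a
  bdd := ⟨1, Eb_le_one ha⟩
  ode := by
    intro t
    have h := iter_eq (fb a) (fb_deriv a)
    have h6 := congrFun (h 6 le_rfl) t
    have h4 := congrFun (h 4 (by norm_num)) t
    have h2 := congrFun (h 2 (by norm_num)) t
    have h0 : fb a 0 = Eb a := rfl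
    rw [h0] at h6 h4 h2
    rw [h6, h4, h2]
    have hp : Eb a t ^ ((a + 6) / a) = Eb (a + 2 + 2 + 2) t := by
      simp only [Eb]
      rw [← Real.rpow_mul (Real.cosh_pos t).le]
      congr 1
      field_simp
      ring
    rw [hp]
    simp only [fb, k4, k2, k0, cC]
    ring

lemma Sol.trans {a : ℝ} {v : ℝ → ℝ} (h : Sol a v) (c : ℝ) : Sol a (fun t => v (t + c)) where
  cd := h.cd.comp (contDiff_id.add contDiff_const)
  pos := fun t => h.pos _
  bdd := by obtain ⟨C, hC⟩ := h.bdd; exact ⟨C, fun t => hC _⟩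
  ode := by
    intro t
    simp only [iteratedDeriv_comp_add_const]
    exact h.ode (t + c)

lemma Sol.refl {a : ℝ} {v : ℝ → ℝ} (h : Sol a v) : Sol a (fun t => v (-t)) where
  cd := h.cd.comp contDiff_neg
  pos := fun t => h.pos _
  bdd := by obtain ⟨C, hC⟩ := h.bdd; exact ⟨C, fun t => hC _⟩
  ode := by
    intro t
    simp only [iteratedDeriv_comp_neg]
    have := h.ode (-t)
    norm_num
    linarith


lemma op1_sub {α : ℝ} {u w : ℝ → ℝ} (hu : Differentiable ℝ u) (hw : Differentiable ℝ w) :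
    op1 α (fun t => u t - w t) = fun t => op1 α u t - op1 α w t := by
  funext t
  have := ((hu t).hasDerivAt.sub (hw t).hasDerivAt).deriv
  have h2 : deriv (fun t => u t - w t) t = deriv u t - deriv w t := this
  simp only [op1, h2]; ring

lemma chain_sub (l : List ℝ) : ∀ u w : ℝ → ℝ, ContDiff ℝ (l.length : WithTop ℕ∞) u →
    ContDiff ℝ (l.length : WithTop ℕ∞) w →
    chainOp l (fun t => u t - w t) = fun t => chainOp l u t - chainOp l w t := by
  induction l with
  | nil => intro u w _ _; rfl
  | cons α l ih =>
    intro u w hu hw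
    have hu' : ContDiff ℝ ((l.length + 1 : ℕ) : WithTop ℕ∞) u := by simpa using hu
    have hw' : ContDiff ℝ ((l.length + 1 : ℕ) : WithTop ℕ∞) w := by simpa using hw
    simp only [chainOp]
    rw [op1_sub (diff_of hu') (diff_of hw')]
    exact ih _ _ (contDiff_op hu') (contDiff_op hw')

lemma chain_const (l : List ℝ) : ∀ m : ℝ, chainOp l (fun _ => m) = fun _ => l.prod * m := by
  induction l with
  | nil => intro m; simp [chainOp]
  | cons α l ih =>
    intro m
    have : op1 α (fun _ => m) = fun _ => α * m := by funext t; simp [op1]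
    simp only [chainOp, this, ih, List.prod_cons]
    funext t; ring

lemma relB_of_bdd {y : ℝ → ℝ} {M : ℝ} (h : ∀ t, |y t| ≤ M) : RelB y :=
  ⟨M, 1, one_pos, fun t => ⟨t, ⟨le_rfl, by linarith⟩, h t⟩⟩

lemma cast6 {y : ℝ → ℝ} {l : List ℝ} (hl : l.length = 6) (hy : ContDiff ℝ 6 y) :
    ContDiff ℝ (l.length : WithTop ℕ∞) y := by
  rw [hl]; exact_mod_cast hy

lemma op_neg_of_pos {α : ℝ} (hα : 0 < α) {y : ℝ → ℝ} (hy : Differentiable ℝ y) (hb : RelB y)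
    (h : ∀ t, 0 < op1 (-α) y t) (t : ℝ) : y t < 0 := by
  have hb' : RelB (fun t => - y t) := by
    obtain ⟨C, L, hL, h⟩ := hb
    exact ⟨C, L, hL, by simpa using h⟩
  have := op_pos' hα (y := fun t => - y t) hy.neg hb' (by
    intro t
    have e : op1 (-α) (fun x => - y x) t = - op1 (-α) y t := by
      simp only [op1, deriv.fun_neg]; ring
    rw [e]; linarith [h t]) t
  linarith

lemma chain_pos {a : ℝ} (ha : 0 < a) {y : ℝ → ℝ} (hy : ContDiff ℝ 6 y) (hb : RelB y)
    (h : ∀ t, chainOp (chL a) y t < 0) : (∀ t, 0 < op1 a y t) ∧ ∀ t, 0 < y t := by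
  have c0 : ContDiff ℝ ((5 + 1 : ℕ) : WithTop ℕ∞) y := by exact_mod_cast hy
  have c1 : ContDiff ℝ ((4 + 1 : ℕ) : WithTop ℕ∞) _ := contDiff_op (α := a) c0
  have c2 : ContDiff ℝ ((3 + 1 : ℕ) : WithTop ℕ∞) _ := contDiff_op (α := a + 2) c1
  have c3 : ContDiff ℝ ((2 + 1 : ℕ) : WithTop ℕ∞) _ := contDiff_op (α := a + 4) c2
  have c4 : ContDiff ℝ ((1 + 1 : ℕ) : WithTop ℕ∞) _ := contDiff_op (α := -a) c3
  have c5 : ContDiff ℝ ((0 + 1 : ℕ) : WithTop ℕ∞) _ := contDiff_op (α := -(a + 2)) c4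
  have b1 := relB_step (α := a) (diff_of c0) hb
  have b2 := relB_step (α := a + 2) (diff_of c1) b1
  have b3 := relB_step (α := a + 4) (diff_of c2) b2
  have b4 := relB_step (α := -a) (diff_of c3) b3
  have b5 := relB_step (α := -(a + 2)) (diff_of c4) b4
  have p5 := op_pos' (by linarith : 0 < a + 4) (diff_of c5) b5 h
  have p4 := op_neg_of_pos (by linarith : 0 < a + 2) (diff_of c4) b4 p5
  have p3 := op_pos' ha (diff_of c3) b3 p4
  have p2 := op_pos (by linarith : 0 < a + 4) (diff_of c2) b2 p3
  have p1 := op_pos (by linarith : 0 < a + 2) (diff_of c1) b1 p2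
  exact ⟨p1, op_pos ha (diff_of c0) hb p1⟩

lemma cC_pos {a : ℝ} (ha : 0 < a) : 0 < cC a := by unfold cC; positivity

lemma Sol.diff {a : ℝ} {u : ℝ → ℝ} (h : Sol a u) : Differentiable ℝ u :=
  h.cd.differentiable (by norm_num)

lemma Sol.chain {a : ℝ} {u : ℝ → ℝ} (h : Sol a u) (t : ℝ) :
    chainOp (chL a) u t = -(cC a * u t ^ ((a + 6) / a)) := by
  rw [chain_eq a h.cd, h.ode]

lemma Sol.relB {a : ℝ} {u : ℝ → ℝ} (h : Sol a u) : RelB u := by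
  obtain ⟨C, hC⟩ := h.bdd
  exact relB_of_bdd (M := C) (fun t => by rw [abs_of_pos (h.pos t)]; exact hC t)

lemma Sol.mono {a : ℝ} (ha : 0 < a) {u : ℝ → ℝ} (h : Sol a u) :
    Monotone (fun t => Real.exp (a * t) * u t) := by
  have := (chain_pos ha h.cd h.relB (by
    intro t
    rw [h.chain]
    have := Real.rpow_pos_of_pos (h.pos t) ((a + 6) / a)
    have := mul_pos (cC_pos ha) this
    linarith)).1
  apply monotone_of_deriv_nonneg
  · intro t; exact (hasDeriv_F h.diff t).differentiableAt
  · intro t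
    rw [(hasDeriv_F h.diff t).deriv]
    exact (mul_pos (Real.exp_pos _) (this t)).le

lemma rpow_lip {p R x y : ℝ} (hp : 1 ≤ p) (hx : 0 < x) (hy : 0 < y) (hxR : x ≤ R) (hyR : y ≤ R) :
    |x ^ p - y ^ p| ≤ p * R ^ (p - 1) * |x - y| := by
  have := Convex.norm_image_sub_le_of_norm_hasDerivWithin_le (f := fun x : ℝ => x ^ p)
    (f' := fun x => p * x ^ (p - 1)) (s := Ioc 0 R) (C := p * R ^ (p - 1)) (x := y) (y := x)
    (fun z hz => (Real.hasDerivAt_rpow_const (Or.inl hz.1.ne')).hasDerivWithinAt)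
    (fun z hz => by
      rw [Real.norm_eq_abs, abs_of_nonneg (by have := hz.1; positivity)]
      have := Real.rpow_le_rpow hz.1.le hz.2 (by linarith : 0 ≤ p - 1)
      gcongr) (convex_Ioc 0 R) ⟨hy, hyR⟩ ⟨hx, hxR⟩
  simpa [Real.norm_eq_abs] using this

lemma pe {a : ℝ} (ha : 0 < a) : 1 ≤ (a + 6) / a := by
  rw [le_div_iff₀ ha]; linarith

lemma chL_len (a : ℝ) : (chL a).length = 6 := rfl

lemma diff_cd {a : ℝ} {u w : ℝ → ℝ} (hu : Sol a u) (hw : Sol a w) :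
    ContDiff ℝ 6 (fun t => u t - w t) := hu.cd.sub hw.cd

lemma diff_chain {a : ℝ} {u w : ℝ → ℝ} (hu : Sol a u) (hw : Sol a w) (t : ℝ) :
    chainOp (chL a) (fun t => u t - w t) t =
      -(cC a * (u t ^ ((a + 6) / a) - w t ^ ((a + 6) / a))) := by
  rw [chain_sub _ _ _ (cast6 (chL_len a) hu.cd) (cast6 (chL_len a) hw.cd)]
  simp only [hu.chain, hw.chain]; ring

lemma diff_lip {a : ℝ} (ha : 0 < a) {u w : ℝ → ℝ} (hu : Sol a u) (hw : Sol a w) {R t : ℝ}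
    (h1 : u t ≤ R) (h2 : w t ≤ R) :
    |chainOp (chL a) (fun t => u t - w t) t| ≤
      cC a * ((a + 6) / a * R ^ ((a + 6) / a - 1)) * |u t - w t| := by
  rw [diff_chain hu hw, abs_neg, abs_mul, abs_of_pos (cC_pos ha), mul_assoc]
  have := rpow_lip (pe ha) (hu.pos t) (hw.pos t) h1 h2
  have := cC_pos ha
  gcongr

lemma diff_bdd {a : ℝ} {u w : ℝ → ℝ} (hu : Sol a u) (hw : Sol a w) :
    ∃ M, 0 < M ∧ (∀ t, u t ≤ M) ∧ (∀ t, w t ≤ M) ∧ ∀ t, |u t - w t| ≤ M := by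
  obtain ⟨C, hC⟩ := hu.bdd
  obtain ⟨D, hD⟩ := hw.bdd
  refine ⟨max C D, lt_of_lt_of_le (hu.pos 0) ((hC 0).trans (le_max_left _ _)),
    fun t => (hC t).trans (le_max_left _ _), fun t => (hD t).trans (le_max_right _ _), fun t => ?_⟩
  have := (hC t).trans (le_max_left _ D)
  have := (hD t).trans (le_max_right C _)
  have := hu.pos t
  have := hw.pos t
  rw [abs_le]; constructor <;> linarith

lemma diff_relB {a : ℝ} {u w : ℝ → ℝ} (hu : Sol a u) (hw : Sol a w) :
    RelB (fun t => u t - w t) := by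
  obtain ⟨M, _, _, _, h⟩ := diff_bdd hu hw
  exact relB_of_bdd h

lemma acc_left {a : ℝ} (ha : 0 < a) {u w : ℝ → ℝ} (hu : Sol a u) (hw : Sol a w) {p : ℝ}
    (hz : ∃ᶠ z in 𝓝[≠] p, u z = w z) : ∀ t ≤ p, u t = w t := by
  obtain ⟨M, _, h1, h2, h3⟩ := diff_bdd hu hw
  have := unique_left (chL a) (by rw [chL_len]; norm_num) (p := p) (fun t => u t - w t)
    (cast6 (chL_len a) (diff_cd hu hw)) h3 (fun t => diff_lip ha hu hw (h1 t) (h2 t))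
    (by simpa [sub_eq_zero] using hz)
  intro t ht
  linarith [this t ht]

lemma freq_neg {P : ℝ → Prop} {p : ℝ} (hz : ∃ᶠ z in 𝓝[≠] p, P z) : ∃ᶠ z in 𝓝[≠] (-p), P (-z) := by
  rw [frequently_nhdsWithin_iff] at hz ⊢
  have : Tendsto (fun x : ℝ => -x) (𝓝 p) (𝓝 (-p)) := (continuous_neg.tendsto p)
  apply this.frequently
  refine hz.mono ?_
  rintro x ⟨h1, h2⟩
  refine ⟨by simpa using h1, ?_⟩
  intro h; exact h2 (neg_injective h)

lemma acc_all {a : ℝ} (ha : 0 < a) {u w : ℝ → ℝ} (hu : Sol a u) (hw : Sol a w) {p : ℝ}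
    (hz : ∃ᶠ z in 𝓝[≠] p, u z = w z) : ∀ t, u t = w t := by
  intro t
  rcases le_total t p with h | h
  · exact acc_left ha hu hw hz t h
  · have := acc_left ha hu.refl hw.refl (p := -p) (freq_neg hz) (-t) (by linarith)
    simpa using this

lemma unb_all {a R : ℝ} (ha : 0 < a) {u w : ℝ → ℝ} (hu : Sol a u) (hw : Sol a w)
    (hR : ∀ t, Real.exp (a * t) * w t ≤ R) (hz : ∀ N, ∃ z > N, u z = w z) : ∀ t, u t = w t := by
  have hR0 : 0 < R := lt_of_lt_of_le (mul_pos (Real.exp_pos _) (hw.pos 0)) (hR 0)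
  have hRu : ∀ t, Real.exp (a * t) * u t ≤ R := by
    intro t
    obtain ⟨z, hz1, hz2⟩ := hz t
    refine (hu.mono ha hz1.le).trans ?_
    simp only [hz2]; exact hR z
  have conv : ∀ x t, Real.exp (a * t) * x ≤ R → x ≤ R * Real.exp (-a * t) := by
    intro x t h
    have e : Real.exp (a * t) * Real.exp (-a * t) = 1 := by
      rw [← Real.exp_add]; ring_nf; simp
    have := mul_le_mul_of_nonneg_right h (Real.exp_pos (-a * t)).le
    calc x = Real.exp (a * t) * x * Real.exp (-a * t) := by linear_combination (-x) * e
      _ ≤ _ := this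
  set C1 := cC a * ((a + 6) / a * R ^ ((a + 6) / a - 1)) with hC1
  have hC1p : 0 < C1 := by have := cC_pos ha; positivity
  have hbd : ∀ t, |chainOp (chL a) (fun t => u t - w t) t| ≤ C1 * Real.exp (-6 * t) * |u t - w t| := by
    intro t
    have := diff_lip ha hu hw (conv _ t (hRu t)) (conv _ t (hR t))
    refine this.trans (le_of_eq ?_)
    have e : (R * Real.exp (-a * t)) ^ ((a + 6) / a - 1) = R ^ ((a + 6) / a - 1) * Real.exp (-6 * t) := by
      rw [Real.mul_rpow hR0.le (Real.exp_pos _).le, ← Real.exp_mul]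
      congr 2; field_simp; ring
    rw [e, hC1]; ring
  have hlim : Tendsto (fun t : ℝ => C1 * Real.exp (-6 * t)) atTop (𝓝 0) := by
    have : Tendsto (fun t : ℝ => Real.exp (-6 * t)) atTop (𝓝 0) :=
      Real.tendsto_exp_atBot.comp (tendsto_id.const_mul_atTop_of_neg (by norm_num))
    simpa using this.const_mul C1
  obtain ⟨T, hT⟩ := (hlim.eventually (gt_mem_nhds (by norm_num : (0:ℝ) < 1/2))).exists_forall_of_atTop
  have key : ∀ k : ℕ, ∀ x ≥ T, |u x - w x| ≤ (R * (1/2) ^ k) * Real.exp (-a * x) := by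
    intro k
    induction k with
    | zero =>
      intro x _
      have h1 := conv _ x (hRu x)
      have h2 := conv _ x (hR x)
      have := hu.pos x
      have := hw.pos x
      rw [abs_le]; constructor <;> simp <;> simp at h1 h2 <;> linarith
    | succ k ih =>
      intro x hx
      have := decay_inf (chL a) (ρ := a + 6) (B := C1 * (R * (1/2) ^ k)) (T := T) (by positivity)
        (by
          intro α hα
          simp only [chL, List.mem_cons, List.not_mem_nil, or_false] at hα
          rcases hα with h | h | h | h | h | h <;> rw [h] <;> linarith)
        (fun t => u t - w t) (cast6 (chL_len a) (diff_cd hu hw))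
        (by simpa [sub_eq_zero] using hz)
        (by
          intro x hx
          refine (hbd x).trans ?_
          have := ih x hx
          calc C1 * Real.exp (-6 * x) * |u x - w x| ≤ C1 * Real.exp (-6 * x) * ((R * (1/2) ^ k) * Real.exp (-a * x)) := by
                gcongr
            _ = C1 * (R * (1/2)^k) * (Real.exp (-6 * x) * Real.exp (-a * x)) := by ring
            _ = _ := by rw [← Real.exp_add]; congr 2; ring) x hx
      refine this.trans ?_
      have e : Real.exp (-(a + 6) * x) = Real.exp (-6 * x) * Real.exp (-a * x) := by
        rw [← Real.exp_add]; congr 1; ring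
      rw [e, pow_succ]
      have h5 := hT x hx
      calc C1 * (R * (1/2)^k) * (Real.exp (-6 * x) * Real.exp (-a * x))
          = (C1 * Real.exp (-6 * x)) * ((R * (1/2)^k) * Real.exp (-a * x)) := by ring
        _ ≤ (1/2) * ((R * (1/2)^k) * Real.exp (-a * x)) := by gcongr
        _ = _ := by ring
  have hzero : ∀ x ≥ T, u x = w x := by
    intro x hx
    have : u x - w x = 0 := by
      apply zero_of_halving (A := R * Real.exp (-a * x))
      intro k
      have := key k x hx
      linarith
    linarith
  apply acc_all ha hu hw (p := T + 1)
  have : ∀ᶠ z in 𝓝[≠] (T + 1), u z = w z := by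
    apply Filter.Eventually.filter_mono nhdsWithin_le_nhds
    filter_upwards [lt_mem_nhds (by linarith : T < T + 1)] with z hz
    exact hzero z (le_of_lt hz)
  exact this.frequently

lemma zeros_finite {a R : ℝ} (ha : 0 < a) {u w : ℝ → ℝ} (hu : Sol a u) (hw : Sol a w)
    (hR : ∀ t, Real.exp (a * t) * w t ≤ R) (hR' : ∀ t, Real.exp (a * t) * w (-t) ≤ R)
    (hne : ∃ t, u t ≠ w t) : {t | u t = w t}.Finite := by
  by_contra hinf
  obtain ⟨t0, ht0⟩ := hne
  by_cases hab : ∀ N, ∃ z > N, u z = w z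
  · exact ht0 (unb_all ha hu hw hR hab t0)
  by_cases hbe : ∀ N, ∃ z > N, u (-z) = w (-z)
  · have := unb_all ha hu.refl hw.refl hR' hbe (-t0)
    simp at this
    exact ht0 this
  push Not at hab hbe
  obtain ⟨N, hN⟩ := hab
  obtain ⟨N', hN'⟩ := hbe
  have hsub : {t | u t = w t} ⊆ Icc (-N') N := by
    intro z hz
    constructor
    · by_contra h
      exact hN' (-z) (by linarith) (by simpa using hz)
    · by_contra h
      exact hN z (by linarith) hz
  obtain ⟨p, _, hp⟩ := Set.Infinite.exists_accPt_of_subset_isCompact hinf isCompact_Icc hsub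
  rw [accPt_iff_frequently_nhdsNE] at hp
  exact ht0 (acc_all ha hu hw hp t0)


lemma count_contra {a : ℝ} (ha : 0 < a) {u w : ℝ → ℝ} (hu : Sol a u) (hw : Sol a w)
    (Z Z1 : Finset ℝ) (hZ : ∀ t, u t = w t → t ∈ Z)
    (h1 : ∀ x ∈ Z1, op1 a (fun t => u t - w t) x = 0) : Z1.card ≤ Z.card := by
  have c0 : ContDiff ℝ ((5 + 1 : ℕ) : WithTop ℕ∞) (fun t => u t - w t) := by
    exact_mod_cast diff_cd hu hw
  obtain ⟨Z2, hc, h2⟩ := chain_zero_count [a + 2, a + 4, -a, -(a + 2), -(a + 4)] (by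
      intro α hα
      simp only [List.mem_cons, List.not_mem_nil, or_false] at hα
      rcases hα with h | h | h | h | h <;> rw [h] <;> intro h <;> linarith)
    (op1 a (fun t => u t - w t)) (contDiff_op c0) (relB_step (diff_of c0) (diff_relB hu hw)) Z1 h1
  rw [← hc]
  apply Finset.card_le_card
  intro x hx
  have h3 : chainOp (chL a) (fun t => u t - w t) x = 0 := h2 x hx
  rw [diff_chain hu hw] at h3
  have h4 : u x ^ ((a + 6) / a) = w x ^ ((a + 6) / a) := by
    have := mul_eq_zero.mp (neg_eq_zero.mp h3)
    have := this.resolve_left (cC_pos ha).ne'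
    linarith
  apply hZ
  exact (Real.rpow_left_inj (hu.pos x).le (hw.pos x).le (by have := pe ha; linarith)).mp h4

lemma no_tangency {a : ℝ} (ha : 0 < a) {u w : ℝ → ℝ} (hu : Sol a u) (hw : Sol a w)
    (hfin : {t | u t = w t}.Finite) {t1 : ℝ} (h0 : u t1 = w t1)
    (h1 : deriv (fun t => u t - w t) t1 = 0) : False := by
  have hd : Differentiable ℝ (fun t => u t - w t) := hu.diff.sub hw.diff
  have hm : ∀ t, t ∈ hfin.toFinset ↔ u t = w t := by intro t; simp
  obtain ⟨Z', hc, hz, -, hn⟩ := zero_count_pos ha hd (diff_relB hu hw) hfin.toFinset (by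
    intro z hz
    have := (hm z).mp hz
    linarith)
  have hnot : t1 ∉ Z' := fun h => hn t1 h ((hm t1).mpr h0)
  have := count_contra ha hu hw hfin.toFinset (insert t1 Z') (fun t ht => (hm t).mpr ht) (by
    intro x hx
    rcases Finset.mem_insert.mp hx with rfl | hx
    · simp only [op1, h1, h0]; ring
    · exact hz x hx)
  rw [Finset.card_insert_of_notMem hnot, hc] at this
  omega

lemma no_tangency_inf {a : ℝ} (ha : 0 < a) {u w : ℝ → ℝ} (hu : Sol a u) (hw : Sol a w)
    (hfin : {t | u t = w t}.Finite)
    (hlim : Tendsto (fun t => Real.exp (a * t) * (u t - w t)) atTop (𝓝 0)) : False := by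
  have hd : Differentiable ℝ (fun t => u t - w t) := hu.diff.sub hw.diff
  have hm : ∀ t, t ∈ hfin.toFinset ↔ u t = w t := by intro t; simp
  obtain ⟨Z', hc, hz, hlt, -⟩ := zero_count_pos ha hd (diff_relB hu hw) hfin.toFinset (by
    intro z hz
    have := (hm z).mp hz
    linarith)
  have hsetup : ∃ t x, t < x ∧ |Real.exp (a * t) * (u t - w t)| < |Real.exp (a * x) * (u x - w x)| ∧
      ∀ z ∈ hfin.toFinset, z ≤ t := by
    rcases hfin.toFinset.eq_empty_or_nonempty with he | hne
    · have : u 0 ≠ w 0 := by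
        intro h
        have := (hm 0).mpr h
        rw [he] at this
        simp at this
      have hp : 0 < |Real.exp (a * 0) * (u 0 - w 0)| :=
        abs_pos.mpr (mul_ne_zero (Real.exp_pos _).ne' (sub_ne_zero.mpr this))
      obtain ⟨t, ht, hs⟩ := relB_small ha (diff_relB hu hw) 0 _ hp
      exact ⟨t, 0, ht, hs, by rw [he]; simp⟩
    · set m := hfin.toFinset.max' hne with hmdef
      have hmm := hfin.toFinset.max'_mem hne
      have h0 := (hm m).mp hmm
      have : u (m + 1) ≠ w (m + 1) := by
        intro h
        have := hfin.toFinset.le_max' _ ((hm _).mpr h)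
        linarith
      have hp : 0 < |Real.exp (a * (m + 1)) * (u (m + 1) - w (m + 1))| :=
        abs_pos.mpr (mul_ne_zero (Real.exp_pos _).ne' (sub_ne_zero.mpr this))
      refine ⟨m, m + 1, by linarith, ?_, fun z hz => hfin.toFinset.le_max' z hz⟩
      rw [h0, sub_self, mul_zero, abs_zero]; exact hp
  obtain ⟨t, x, htx, hF, hZt⟩ := hsetup
  have hp : 0 < |Real.exp (a * x) * (u x - w x)| := lt_of_le_of_lt (abs_nonneg _) hF
  have hlim' : Tendsto (fun t => |Real.exp (a * t) * (u t - w t)|) atTop (𝓝 0) := by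
    simpa using hlim.abs
  obtain ⟨z, hz1, hz2⟩ := ((hlim'.eventually (gt_mem_nhds hp)).and (eventually_gt_atTop x)).exists
  obtain ⟨ξ, hξ, he⟩ := rolle_bump (contF (α := a) hd) htx hz2 hF hz1
  have h0 := op_zero_of_extr hd he
  have hnot : ξ ∉ Z' := by
    intro h
    obtain ⟨z, hz, hl⟩ := hlt ξ h
    have := hZt z hz
    linarith [hξ.1]
  have := count_contra ha hu hw hfin.toFinset (insert ξ Z') (fun t ht => (hm t).mpr ht) (by
    intro x hx
    rcases Finset.mem_insert.mp hx with rfl | hx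
    · exact h0
    · exact hz x hx)
  rw [Finset.card_insert_of_notMem hnot, hc] at this
  omega

lemma Eb_neg (a t : ℝ) : Eb a (-t) = Eb a t := by simp [Eb]

lemma exp_Eb (a s : ℝ) : Real.exp (a * s) * Eb a s = ((1 + Real.exp (-2 * s)) / 2) ^ (-a) := by
  have e : (1 + Real.exp (-2 * s)) / 2 = Real.exp (-s) * Real.cosh s := by
    rw [Real.cosh_eq]
    have e1 : Real.exp (-s) * Real.exp s = 1 := by rw [← Real.exp_add]; simp
    have e2 : Real.exp (-s) * Real.exp (-s) = Real.exp (-2 * s) := by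
      rw [← Real.exp_add]; congr 1; ring
    linear_combination (-1/2) * e1 - (1/2) * e2
  rw [e, Real.mul_rpow (Real.exp_pos _).le (Real.cosh_pos s).le, ← Real.exp_mul]
  simp only [Eb]; congr 2; ring

lemma exp_Eb_le {a : ℝ} (ha : 0 < a) (s : ℝ) : Real.exp (a * s) * Eb a s ≤ 2 ^ a := by
  rw [exp_Eb]
  have h : (2:ℝ) ^ a = (1/2) ^ (-a) := by
    rw [one_div, Real.inv_rpow (by norm_num), Real.rpow_neg (by norm_num), inv_inv]
  rw [h]
  apply Real.rpow_le_rpow_of_nonpos (by norm_num) _ (by linarith)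
  linarith [Real.exp_pos (-2 * s)]

lemma exp_Eb_lim (a : ℝ) : Tendsto (fun s => Real.exp (a * s) * Eb a s) atTop (𝓝 (2 ^ a)) := by
  simp only [exp_Eb]
  have h : (2:ℝ) ^ a = ((1 + 0)/2) ^ (-a) := by
    rw [add_zero, one_div, Real.inv_rpow (by norm_num), Real.rpow_neg (by norm_num), inv_inv]
  rw [h]
  have h1 : Tendsto (fun t : ℝ => Real.exp (-2 * t)) atTop (𝓝 0) :=
    Real.tendsto_exp_atBot.comp (tendsto_id.const_mul_atTop_of_neg (by norm_num))
  exact ((h1.const_add 1).div_const 2).rpow_const (Or.inl (by norm_num))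

lemma exp_mul_le (a t τ x : ℝ) :
    Real.exp (a * t) * x = Real.exp (a * τ) * (Real.exp (a * (t - τ)) * x) := by
  rw [← mul_assoc, ← Real.exp_add]; congr 2; ring

/-- translated bubble -/
def Bt (a τ : ℝ) : ℝ → ℝ := fun t => Eb a (t - τ)

lemma sol_Bt {a : ℝ} (ha : 0 < a) (τ : ℝ) : Sol a (Bt a τ) := (sol_Eb ha).trans (-τ)

lemma Bt_fin {a : ℝ} (ha : 0 < a) {u : ℝ → ℝ} (hu : Sol a u) (h1 : 1 < u 0) (τ : ℝ) :
    {t | u t = Bt a τ t}.Finite := by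
  apply zeros_finite ha hu (sol_Bt ha τ) (R := Real.exp (a * |τ|) * 2 ^ a)
  · intro t
    rw [exp_mul_le a t τ]
    have h1 := exp_Eb_le ha (t - τ)
    have h2 : Real.exp (a * τ) ≤ Real.exp (a * |τ|) := by
      apply Real.exp_le_exp.mpr
      have := le_abs_self τ
      gcongr
    exact mul_le_mul h2 h1 (mul_pos (Real.exp_pos _) (Eb_pos _ _)).le (Real.exp_pos _).le
  · intro t
    have e : Bt a τ (-t) = Eb a (t - (-τ)) := by
      rw [← Eb_neg]; simp only [Bt]; congr 1; ring
    rw [e, exp_mul_le a t (-τ)]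
    have h1 := exp_Eb_le ha (t - (-τ))
    have h2 : Real.exp (a * -τ) ≤ Real.exp (a * |τ|) := by
      apply Real.exp_le_exp.mpr
      have := neg_le_abs τ
      gcongr
    exact mul_le_mul h2 h1 (mul_pos (Real.exp_pos _) (Eb_pos _ _)).le (Real.exp_pos _).le
  · refine ⟨0, ?_⟩
    have := Eb_le_one ha (0 - τ)
    simp only [Bt]; intro h; linarith

def Em (a : ℝ) : ℝ → ℝ := fun s => Eb a (max s 0)

lemma Em_cont (a : ℝ) : Continuous (Em a) :=
  (Eb_contDiff a).continuous.comp (continuous_id.max continuous_const)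

lemma Em_of_nonpos (a : ℝ) {s : ℝ} (h : s ≤ 0) : Em a s = 1 := by
  simp [Em, max_eq_right h, Eb]

lemma Em_of_nonneg (a : ℝ) {s : ℝ} (h : 0 ≤ s) : Em a s = Eb a s := by
  simp [Em, max_eq_left h]

lemma Eb_le_Em {a : ℝ} (ha : 0 < a) (s : ℝ) : Eb a s ≤ Em a s := by
  rcases le_total s 0 with h | h
  · rw [Em_of_nonpos a h]; exact Eb_le_one ha s
  · rw [Em_of_nonneg a h]

lemma exp_Em_le {a : ℝ} (ha : 0 < a) (s : ℝ) : Real.exp (a * s) * Em a s ≤ 2 ^ a := by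
  refine le_trans ?_ (exp_Eb_le ha (max s 0))
  apply mul_le_mul_of_nonneg_right _ (Eb_pos _ _).le
  apply Real.exp_le_exp.mpr
  have := le_max_left s 0
  gcongr

lemma exp_Em_le' {a : ℝ} (ha : 0 < a) (t τ : ℝ) :
    Real.exp (a * t) * Em a (t - τ) ≤ 2 ^ a * Real.exp (a * τ) := by
  rw [exp_mul_le a t τ, mul_comm (2 ^ a)]
  exact mul_le_mul_of_nonneg_left (exp_Em_le ha _) (Real.exp_pos _).le

lemma right_side {a : ℝ} (ha : 0 < a) {v : ℝ → ℝ} (hv : Sol a v) (h0 : 1 < v 0) :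
    ∀ t ≥ 0, 1 ≤ v t := by
  by_contra hcon
  push Not at hcon
  obtain ⟨ts, hts0, hts⟩ := hcon
  have hvc : Continuous v := hv.diff.continuous
  have hmono := hv.mono ha
  set S : Set ℝ := {τ | ∀ t ≥ 0, Em a (t - τ) ≤ v t} with hS
  have comp : ∀ t τ x, 2 ^ a * Real.exp (a * τ) ≤ Real.exp (a * x) * v x → x ≤ t → Em a (t - τ) ≤ v t := by
    intro t τ x h hxt
    have h1 := (exp_Em_le' ha t τ).trans (h.trans (hmono hxt))
    exact le_of_mul_le_mul_left h1 (Real.exp_pos _)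
  have hne : S.Nonempty := by
    refine ⟨Real.log (v 0 / 2 ^ a) / a, fun t ht => comp t _ 0 ?_ ht⟩
    have h2 : (0:ℝ) < 2 ^ a := by positivity
    rw [mul_div_cancel₀ _ ha.ne', Real.exp_log (div_pos (by linarith) h2)]
    rw [mul_div_cancel₀ _ h2.ne']
    simp
  have hbdd : BddAbove S := by
    refine ⟨ts, fun τ hτ => ?_⟩
    by_contra h
    push Not at h
    have h1 := hτ ts hts0
    rw [Em_of_nonpos a (by linarith)] at h1
    linarith
  have hclosed : IsClosed S := by
    have e : S = ⋂ t : ℝ, ⋂ _ : t ≥ 0, {τ | Em a (t - τ) ≤ v t} := by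
      ext τ; simp [hS]
    rw [e]
    refine isClosed_iInter fun t => isClosed_iInter fun _ => ?_
    exact isClosed_le ((Em_cont a).comp (continuous_const.sub continuous_id)) continuous_const
  set τ1 := sSup S with hτ1
  have hmem : τ1 ∈ S := hclosed.csSup_mem hne hbdd
  by_cases hB : ∀ N ≥ 0, Real.exp (a * N) * v N ≤ 2 ^ a * Real.exp (a * τ1)
  · apply no_tangency_inf ha hv (sol_Bt ha τ1) (Bt_fin ha hv h0 τ1)
    have hl : Tendsto (fun t => Real.exp (a * τ1) * (Real.exp (a * (t - τ1)) * Eb a (t - τ1))) atTop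
        (𝓝 (Real.exp (a * τ1) * 2 ^ a)) :=
      ((exp_Eb_lim a).comp (tendsto_atTop_add_const_right atTop (-τ1) tendsto_id)).const_mul _
    have hl2 : Tendsto (fun t => 2 ^ a * Real.exp (a * τ1) - Real.exp (a * t) * Bt a τ1 t) atTop (𝓝 0) := by
      have := hl.const_sub (2 ^ a * Real.exp (a * τ1))
      rw [mul_comm (Real.exp (a * τ1)), sub_self] at this
      refine this.congr (fun t => ?_)
      rw [exp_mul_le a t τ1]; rfl
    refine tendsto_of_tendsto_of_tendsto_of_le_of_le' tendsto_const_nhds hl2 ?_ ?_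
    · filter_upwards [eventually_ge_atTop 0] with t ht
      have h1 := hmem t ht
      have h2 := Eb_le_Em ha (t - τ1)
      apply mul_nonneg (Real.exp_pos _).le
      simp only [Bt]; linarith
    · filter_upwards [eventually_ge_atTop 0] with t ht
      have := hB t ht
      linarith
  · push Not at hB
    obtain ⟨N, hN0, hN⟩ := hB
    have htouch : ∃ t ∈ Icc 0 N, v t ≤ Em a (t - τ1) := by
      by_contra hc
      push Not at hc
      have hev1 : ∀ᶠ τ in 𝓝 τ1, ∀ t ∈ Icc 0 N, Em a (t - τ) < v t := by
        apply isCompact_Icc.eventually_forall_of_forall_eventually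
        intro t ht
        have hcont : Continuous (fun z : ℝ × ℝ => v z.2 - Em a (z.2 - z.1)) :=
          (hvc.comp continuous_snd).sub ((Em_cont a).comp (continuous_snd.sub continuous_fst))
        have hlt : (0:ℝ) < (fun z : ℝ × ℝ => v z.2 - Em a (z.2 - z.1)) (τ1, t) := sub_pos.mpr (hc t ht)
        have := hcont.continuousAt.eventually (lt_mem_nhds hlt)
        filter_upwards [this] with z hz
        linarith
      have hev2 : ∀ᶠ τ in 𝓝 τ1, 2 ^ a * Real.exp (a * τ) < Real.exp (a * N) * v N := by
        have hcont : Continuous (fun τ : ℝ => 2 ^ a * Real.exp (a * τ)) := by fun_prop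
        exact hcont.continuousAt.eventually (gt_mem_nhds hN)
      have hev3 : ∃ᶠ τ in 𝓝 τ1, τ1 < τ := by
        have : ∀ᶠ τ in 𝓝[>] τ1, τ1 < τ := self_mem_nhdsWithin
        exact this.frequently.filter_mono nhdsWithin_le_nhds
      obtain ⟨τ, hlt, h1, h2⟩ := (hev3.and_eventually (hev1.and hev2)).exists
      have : τ ∈ S := by
        intro t ht
        rcases le_total t N with h | h
        · exact (h1 t ⟨ht, h⟩).le
        · exact comp t τ N h2.le h
      have := le_csSup hbdd this
      linarith
    obtain ⟨t1, ht1, hle⟩ := htouch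
    have heq : v t1 = Em a (t1 - τ1) := le_antisymm hle (hmem t1 ht1.1)
    have ht1pos : 0 < t1 := by
      rcases eq_or_lt_of_le ht1.1 with h | h
      · exfalso
        rw [← h] at heq
        have : Em a (0 - τ1) ≤ 1 := Eb_le_one ha _
        linarith
      · exact h
    set τ' := min t1 τ1 with hτ'
    have hEb : Bt a τ' t1 = v t1 := by
      rw [heq]
      simp only [Bt, Em]
      congr 1
      rcases le_total t1 τ1 with h | h
      · rw [hτ', min_eq_left h, max_eq_right] <;> linarith
      · rw [hτ', min_eq_right h, max_eq_left]; linarith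
    have hev : ∀ᶠ t in 𝓝 t1, Bt a τ' t ≤ v t := by
      rcases lt_or_ge t1 τ1 with h | h
      · filter_upwards [gt_mem_nhds h, lt_mem_nhds ht1pos] with t hta htb
        have h1 := hmem t (le_of_lt htb)
        rw [Em_of_nonpos a (by linarith)] at h1
        exact (Eb_le_one ha _).trans h1
      · filter_upwards [lt_mem_nhds ht1pos] with t htb
        have h1 := hmem t (le_of_lt htb)
        rw [hτ', min_eq_right h]
        exact (Eb_le_Em ha _).trans h1
    have hmin : IsLocalMin (fun t => v t - Bt a τ' t) t1 := by
      filter_upwards [hev] with t ht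
      linarith
    exact no_tangency ha hv (sol_Bt ha τ') (Bt_fin ha hv h0 τ') hEb.symm hmin.deriv_eq_zero

lemma main_le {a : ℝ} (ha : 0 < a) (hCk : k0 a < cC a) {v : ℝ → ℝ} (hv : Sol a v) (h0 : 1 < v 0) : False := by
  have hge : ∀ t, 1 ≤ v t := by
    intro t
    rcases le_total 0 t with h | h
    · exact right_side ha hv h0 t h
    · have := right_side ha hv.refl (by simpa using h0) (-t) (by linarith)
      simpa using this
  set i := sInf (range v) with hi
  have hbb : BddBelow (range v) := ⟨1, by rintro _ ⟨t, rfl⟩; exact hge t⟩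
  have hi1 : 1 ≤ i := le_csInf (range_nonempty v) (by rintro _ ⟨t, rfl⟩; exact hge t)
  have hiv : ∀ t, i ≤ v t := fun t => csInf_le hbb ⟨t, rfl⟩
  have hk : 0 < k0 a := by unfold k0; positivity
  set m := i * (cC a + k0 a) / (2 * k0 a) with hm
  have hkm : k0 a * m = i * (cC a + k0 a) / 2 := by rw [hm]; field_simp
  have him : i < m := by
    have : k0 a * i < k0 a * m := by rw [hkm]; nlinarith
    exact lt_of_mul_lt_mul_left this hk.le
  have hpos := (chain_pos ha (y := fun t => v t - m) (hv.cd.sub contDiff_const) (by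
      obtain ⟨C, hC⟩ := hv.bdd
      apply relB_of_bdd (M := C + |m|)
      intro t
      have h1 := hC t
      have h2 := hv.pos t
      have h3 := neg_abs_le m
      have h4 := le_abs_self m
      rw [abs_le]; constructor <;> linarith) (by
      intro t
      rw [chain_sub _ _ _ (cast6 (chL_len a) hv.cd) contDiff_const, chain_const]
      simp only [hv.chain]
      have e : (chL a).prod = - k0 a := by simp [chL, k0]; ring
      rw [e]
      have h1 : v t ≤ v t ^ ((a + 6) / a) := by
        calc v t = v t ^ (1:ℝ) := by simp
          _ ≤ _ := Real.rpow_le_rpow_of_exponent_le (hge t) (pe ha)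
      have h2 : cC a * i ≤ cC a * v t ^ ((a + 6) / a) := by
        have := cC_pos ha
        have := (hiv t).trans h1
        gcongr
      nlinarith)).2
  have : m ≤ i := le_csInf (range_nonempty v) (by rintro _ ⟨t, rfl⟩; have := hpos t; linarith)
  linarith

end Helpers

/-- Every positive bounded C⁶ solution of the sixth-order Emden–Fowler ODE satisfies
v(t) ≤ 1 for all t. -/
theorem bounded_solutions_le_one (n : ℕ) (hn : 7 ≤ n) (v : ℝ → ℝ) (hv : ContDiff ℝ 6 v)
    (hpos : ∀ t, 0 < v t) (hbd : ∃ C : ℝ, ∀ t : ℝ, v t ≤ C)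
    (hsol : ∀ t : ℝ,
      -(iteratedDeriv 6 v t) + K4 n * iteratedDeriv 4 v t - K2 n * iteratedDeriv 2 v t
        + K0 n * v t = cst n * v t ^ (((n:ℝ)+6)/((n:ℝ)-6))) :
    ∀ t : ℝ, v t ≤ 1 := by

  intro t0
  by_contra hcon
  push Not at hcon
  have hn' : (7:ℝ) ≤ (n:ℝ) := by exact_mod_cast hn
  obtain ⟨a, ha⟩ : ∃ a : ℝ, a = ((n:ℝ) - 6) / 2 := ⟨_, rfl⟩
  have hna : (n:ℝ) = 2 * a + 6 := by rw [ha]; ring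
  have ha0 : 0 < a := by linarith
  have e4 : K4 n = k4 a := by simp only [K4, k4, hna]; ring
  have e2 : K2 n = k2 a := by simp only [K2, k2, hna]; ring
  have e0 : K0 n = k0 a := by simp only [K0, k0, hna]; ring
  have ec : cst n = cC a := by simp only [cst, cC, hna]; ring
  have ep : ((n:ℝ) + 6) / ((n:ℝ) - 6) = (a + 6) / a := by
    rw [hna, div_eq_div_iff (by linarith) ha0.ne']; ring
  have hs : Sol a v := by
    refine ⟨hv, hpos, hbd, fun t => ?_⟩
    have := hsol t
    rw [e4, e2, e0, ec, ep] at this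
    linarith
  have hs' := hs.trans t0
  refine main_le ha0 ?_ hs' (by simpa using hcon)
  have e : cC a - k0 a = a * (a + 2) * (a + 4) * (3 * a ^ 2 + 15 * a + 15) := by
    simp only [cC, k0]; ring
  have : 0 < a * (a + 2) * (a + 4) * (3 * a ^ 2 + 15 * a + 15) := by positivity
  linarith
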